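/- arXiv:math/0506207 — 2 statements merged into one kernel-verified Lean document; each statement's English description precedes it below -/
import Mathlib

section
/- For each natural number n ≥ 1 and every complex number z with Re z > n, it holds that A(z) = (−1)ⁿ·( A(z − n) + ((−1)ⁿ − qₙ(z))·Γ(z+2) ). -/
open MeasureTheory

/-- The alternating Kurepa function, defined for `Re z > 0` by
`A(z) = ∫₀^∞ e^{−t} (t^{z+1} − e^{iπz} t)/(t+1) dt`, where `(−1)^z` is taken as the
principal value `e^{iπz}`. -/
noncomputable def altKurepa (z : ℂ) : ℂ :=
  ∫ t in Set.Ioi (0 : ℝ),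
    (Real.exp (-t) : ℂ) * ((t : ℂ) ^ (z + 1) -
      Complex.exp ((Real.pi : ℂ) * Complex.I * z) * (t : ℂ)) / ((t : ℂ) + 1)

/-- The rational functions `qₙ`: `q₁(z) = −z/(z+1)`, `q₂(z) = (z²+1)/(z(z+1))`, and
`qₙ(z) = −((z−n+1)/(z−n+2))·qₙ₋₁(z) + (1/(z−n+2))·qₙ₋₂(z)` for `n ≥ 3`.
(The value of `q₀` is an irrelevant junk value.) -/
noncomputable def kurepaQ : ℕ → ℂ → ℂ
  | 0, _ => 1
  | 1, z => -z / (z + 1)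
  | 2, z => (z ^ 2 + 1) / (z * (z + 1))
  | (n + 3), z =>
      -((z - ((n : ℂ) + 3) + 1) / (z - ((n : ℂ) + 3) + 2)) * kurepaQ (n + 2) z +
        (1 / (z - ((n : ℂ) + 3) + 2)) * kurepaQ (n + 1) z

/-- The damped Gamma integrand `e^{-t} t^w / (t + 1)` is integrable on `(0, ∞)`. -/
lemma integrableOn_exp_neg_mul_cpow_div_add_one {w : ℂ} (hw : -1 < w.re) :
    IntegrableOn (fun t : ℝ => (Real.exp (-t) : ℂ) * (t : ℂ) ^ w / ((t : ℂ) + 1))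
      (Set.Ioi 0) := by
  have hG : IntegrableOn (fun t : ℝ => (Real.exp (-t) : ℂ) * (t : ℂ) ^ w) (Set.Ioi 0) := by
    have h := Complex.GammaIntegral_convergent (s := w + 1)
      (by rw [Complex.add_re, Complex.one_re]; linarith)
    simpa using h
  refine Integrable.mono hG ?_ ?_
  · exact hG.aestronglyMeasurable.div₀
      (Measurable.aestronglyMeasurable (f := fun t : ℝ => (t : ℂ) + 1) (by fun_prop))
  · filter_upwards [ae_restrict_mem measurableSet_Ioi] with t ht
    have ht : (0 : ℝ) < t := ht
    rw [norm_div]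
    apply div_le_self (norm_nonneg _)
    have h : ((t : ℂ) + 1) = ((t + 1 : ℝ) : ℂ) := by push_cast; rfl
    rw [h, Complex.norm_of_nonneg (by positivity)]
    linarith

/-- The integrand defining `altKurepa z` is integrable. -/
lemma integrableOn_altKurepa {z : ℂ} (hz : 0 < z.re) :
    IntegrableOn (fun t : ℝ => (Real.exp (-t) : ℂ) * ((t : ℂ) ^ (z + 1) -
      Complex.exp ((Real.pi : ℂ) * Complex.I * z) * (t : ℂ)) / ((t : ℂ) + 1)) (Set.Ioi 0) := by
  have h₁ := integrableOn_exp_neg_mul_cpow_div_add_one (w := z + 1)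
    (by rw [Complex.add_re, Complex.one_re]; linarith)
  have h₂ := integrableOn_exp_neg_mul_cpow_div_add_one (w := 1) (by norm_num)
  refine (h₁.sub (h₂.const_mul (Complex.exp ((Real.pi : ℂ) * Complex.I * z)))).congr
    (Filter.Eventually.of_forall fun t => ?_)
  simp only [Pi.sub_apply, Complex.cpow_one]
  ring

/-- The functional equation `A(z) + A(z - 1) = Γ(z + 1)`. -/
lemma altKurepa_add_altKurepa_sub_one {z : ℂ} (hz : 1 < z.re) :
    altKurepa z + altKurepa (z - 1) = Complex.Gamma (z + 1) := by
  have hexp : Complex.exp ((Real.pi : ℂ) * Complex.I * (z - 1)) =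
      -Complex.exp ((Real.pi : ℂ) * Complex.I * z) := by
    rw [mul_sub, mul_one, Complex.exp_sub, Complex.exp_pi_mul_I, div_neg, div_one]
  rw [altKurepa, altKurepa, ← integral_add (integrableOn_altKurepa (by linarith))
    (integrableOn_altKurepa (by rw [Complex.sub_re, Complex.one_re]; linarith)),
    Complex.Gamma_eq_integral (by rw [Complex.add_re, Complex.one_re]; linarith),
    Complex.GammaIntegral]
  refine setIntegral_congr_fun measurableSet_Ioi fun t ht => ?_
  have ht : (0 : ℝ) < t := ht
  have ht0 : (t : ℂ) ≠ 0 := by exact_mod_cast ht.ne'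
  have ht1 : (t : ℂ) + 1 ≠ 0 := by exact_mod_cast (by positivity : t + 1 ≠ 0)
  simp only [hexp, sub_add_cancel, add_sub_cancel_right, Complex.cpow_add _ _ ht0,
    Complex.cpow_one]
  field_simp
  ring

/-- Consecutive `qₙ` satisfy `(qₙ(z) + qₙ₊₁(z)) Γ(z + 2) = Γ(z - n + 1)`. -/
lemma kurepaQ_add_kurepaQ_succ_mul_Gamma (n : ℕ) {z : ℂ} (hz : (n : ℝ) < z.re) :
    (kurepaQ n z + kurepaQ (n + 1) z) * Complex.Gamma (z + 2) =
      Complex.Gamma (z - n + 1) := by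
  have hz0 : 0 < z.re := n.cast_nonneg.trans_lt hz
  have hne0 : z ≠ 0 := fun h => by simp [h] at hz0
  have hne1 : z + 1 ≠ 0 := fun h => by
    have := congrArg Complex.re h
    simp at this
    linarith
  have hG : Complex.Gamma (z + 2) = (z + 1) * Complex.Gamma (z + 1) := by
    rw [← Complex.Gamma_add_one _ hne1]; ring_nf
  induction n with
  | zero =>
    simp only [kurepaQ, hG, Nat.cast_zero, sub_zero]
    field_simp
    ring
  | succ n ih =>
    cases n with
    | zero =>
      simp only [kurepaQ, hG, Complex.Gamma_add_one _ hne0, zero_add, Nat.cast_one,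
        sub_add_cancel]
      field_simp
      ring
    | succ m =>
      have ih := ih (by push_cast at hz ⊢; linarith)
      have hne : z - m - 1 ≠ 0 := fun h => by
        have := congrArg Complex.re h
        simp at this
        push_cast at hz
        linarith
      have hG' : Complex.Gamma (z - (m + 1 : ℕ) + 1) =
          (z - m - 1) * Complex.Gamma (z - (m + 1 + 1 : ℕ) + 1) := by
        rw [show z - ((m + 1 + 1 : ℕ) : ℂ) + 1 = z - m - 1 by push_cast; ring,
          ← Complex.Gamma_add_one _ hne]
        push_cast
        ring_nf
      rw [hG'] at ih
      apply mul_left_cancel₀ hne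
      rw [← ih, kurepaQ, show z - ((m : ℂ) + 3) + 2 = z - m - 1 by ring]
      field_simp
      ring

/-- For each `n ≥ 1` and every complex `z` with `Re z > n`,
`A(z) = (−1)ⁿ·( A(z − n) + ((−1)ⁿ − qₙ(z))·Γ(z+2) )`. -/
theorem altKurepa_eq_shift_kurepaQ (n : ℕ) (hn : 1 ≤ n) (z : ℂ) (hz : (n : ℝ) < z.re) :
    altKurepa z =
      (-1 : ℂ) ^ n * (altKurepa (z - (n : ℂ)) +
        ((-1 : ℂ) ^ n - kurepaQ n z) * Complex.Gamma (z + 2)) := by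
  clear hn
  induction n with
  | zero => simp [kurepaQ]
  | succ n ih =>
    push_cast at hz
    have hn : (n : ℝ) < z.re := by linarith
    have hA := altKurepa_add_altKurepa_sub_one (z := z - n) (by simp; linarith)
    have hQ := kurepaQ_add_kurepaQ_succ_mul_Gamma n hn
    rw [ih hn]
    push_cast
    rw [← sub_sub]
    linear_combination (-1 : ℂ) ^ n * (hA - hQ)
end

section
/- Let x₁ ∈ (−2, 0) be the unique zero of F in (−2, 0). Then for every real x ∈ (−1, 1+x₁] ∪ [1, ∞) one has Γ(x+1) ≥ F(x), with equality if and only if x = 1 + x₁ or x = 1. -/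
open MeasureTheory

/-- The real part of the alternating Kurepa function:
`F(x) = ∫₀^∞ e^{−t} (t^{x+1} − cos(πx)·t)/(t+1) dt`, convergent for `x > −2`. -/
noncomputable def reAltKurepa (x : ℝ) : ℝ :=
  ∫ t in Set.Ioi (0 : ℝ), Real.exp (-t) * (t ^ (x + 1) - Real.cos (Real.pi * x) * t) / (t + 1)

open Set Filter Topology

lemma integrableOn_exp_neg_mul_rpow {r : ℝ} (hr : -1 < r) :
    IntegrableOn (fun t : ℝ => Real.exp (-t) * t ^ r) (Ioi 0) := by
  simpa using Real.GammaIntegral_convergent (s := r + 1) (by linarith)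

lemma abs_integrand_le {t r k : ℝ} (ht : 0 < t) (hk : |k| ≤ 1) :
    |Real.exp (-t) * (t ^ r - k * t) / (t + 1)| ≤
      Real.exp (-t) * t ^ r + Real.exp (-t) * t ^ (1 : ℝ) := by
  have hr : 0 < t ^ r := Real.rpow_pos_of_pos ht r
  rw [abs_div, abs_mul, abs_of_pos (Real.exp_pos _), abs_of_pos (by linarith : 0 < t + 1),
    div_le_iff₀ (by linarith), Real.rpow_one, ← mul_add, mul_assoc]
  refine mul_le_mul_of_nonneg_left ?_ (Real.exp_pos _).le
  have h1 : |t ^ r - k * t| ≤ t ^ r + t := by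
    calc |t ^ r - k * t| ≤ |t ^ r| + |k * t| := abs_sub _ _
      _ ≤ t ^ r + t := by
        rw [abs_of_pos hr, abs_mul, abs_of_pos ht]
        nlinarith
  nlinarith

lemma integrableOn_reAltKurepa_integrand {r k : ℝ} (hr : -1 < r) (hk : |k| ≤ 1) :
    IntegrableOn (fun t : ℝ => Real.exp (-t) * (t ^ r - k * t) / (t + 1)) (Ioi 0) := by
  refine Integrable.mono' ((integrableOn_exp_neg_mul_rpow hr).add
    (integrableOn_exp_neg_mul_rpow (r := 1) (by norm_num))) ?_ ?_
  · exact Measurable.aestronglyMeasurable (by fun_prop)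
  · filter_upwards [ae_restrict_mem measurableSet_Ioi] with t ht
    exact abs_integrand_le ht hk

/-- The functional equation `F(x) + F(x - 1) = Γ(x + 1)`. -/
lemma reAltKurepa_add_reAltKurepa_sub_one {x : ℝ} (hx : -1 < x) :
    reAltKurepa x + reAltKurepa (x - 1) = Real.Gamma (x + 1) := by
  unfold reAltKurepa
  rw [Real.Gamma_eq_integral (by linarith), ← integral_add
    (integrableOn_reAltKurepa_integrand (by linarith) (Real.abs_cos_le_one _))
    (integrableOn_reAltKurepa_integrand (by linarith) (Real.abs_cos_le_one _))]
  refine setIntegral_congr_fun measurableSet_Ioi fun t (ht : 0 < t) => ?_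
  have h1 : Real.cos (Real.pi * (x - 1)) = -Real.cos (Real.pi * x) := by
    rw [mul_sub, mul_one, Real.cos_sub_pi]
  have h2 : t + 1 ≠ 0 := by linarith
  simp only [h1, Real.rpow_add_one ht.ne', sub_add_cancel, add_sub_cancel_right]
  field_simp
  ring

lemma continuousOn_reAltKurepa {a : ℝ} (ha : -2 < a) :
    ContinuousOn reAltKurepa (Icc a 0) := by
  unfold reAltKurepa
  refine continuousOn_of_dominated (bound := fun t => (Real.exp (-t) * t ^ (a + 1) +
    Real.exp (-t) * t ^ (1 : ℝ)) + Real.exp (-t) * t ^ (1 : ℝ)) ?_ ?_ ?_ ?_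
  · exact fun y _ => Measurable.aestronglyMeasurable (by fun_prop)
  · intro y hy
    filter_upwards [ae_restrict_mem measurableSet_Ioi] with t ht
    refine (abs_integrand_le ht (Real.abs_cos_le_one _)).trans ?_
    gcongr
    rw [← mul_add]
    refine mul_le_mul_of_nonneg_left ?_ (Real.exp_pos _).le
    have ht' : 0 < t := ht
    have h1 := Real.rpow_pos_of_pos ht' (a + 1)
    have h2 := Real.rpow_pos_of_pos ht' (1 : ℝ)
    rcases le_total t 1 with h | h
    · exact (Real.rpow_le_rpow_of_exponent_ge ht' h (by linarith [hy.1])).trans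
        (le_add_of_nonneg_right h2.le)
    · exact (Real.rpow_le_rpow_of_exponent_le h (by linarith [hy.2])).trans
        (le_add_of_nonneg_left h1.le)
  · have h1 := integrableOn_exp_neg_mul_rpow (r := 1) (by norm_num)
    exact ((integrableOn_exp_neg_mul_rpow (r := a + 1) (by linarith)).add h1).add h1
  · filter_upwards [ae_restrict_mem measurableSet_Ioi] with t ht
    have ht' : t ≠ 0 := ne_of_gt ht
    refine Continuous.continuousOn ?_
    have : Continuous fun y : ℝ => t ^ (y + 1) :=
      continuous_const.rpow (by fun_prop) fun _ => Or.inl ht'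
    fun_prop

lemma reAltKurepa_eq_add {x : ℝ} (hx : -2 < x) :
    reAltKurepa x =
      (∫ t in Ioc (0 : ℝ) 1,
        Real.exp (-t) * (t ^ (x + 1) - Real.cos (Real.pi * x) * t) / (t + 1)) +
      ∫ t in Ioi (1 : ℝ),
        Real.exp (-t) * (t ^ (x + 1) - Real.cos (Real.pi * x) * t) / (t + 1) := by
  have h := integrableOn_reAltKurepa_integrand (r := x + 1) (by linarith)
    (Real.abs_cos_le_one (Real.pi * x))
  unfold reAltKurepa
  rw [← Ioc_union_Ioi_eq_Ioi zero_le_one] at h ⊢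
  exact setIntegral_union (Ioc_disjoint_Ioi le_rfl) measurableSet_Ioi h.left_of_union
    h.right_of_union

lemma reAltKurepa_pos_of_near_neg_two {ε : ℝ} (h0 : 0 < ε) (h1 : ε < 1 / 12) :
    0 < reAltKurepa (-2 + ε) := by
  set k := Real.cos (Real.pi * (-2 + ε)) with hkdef
  have hk : |k| ≤ 1 := Real.abs_cos_le_one _
  have hk1 : k ≤ 1 := (abs_le.1 hk).2
  have hi := integrableOn_reAltKurepa_integrand (r := -2 + ε + 1) (by linarith) hk
  rw [reAltKurepa_eq_add (by linarith), ← hkdef]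
  have hr : -1 < -2 + ε + 1 := by linarith
  have hA : IntegrableOn (fun t : ℝ => t ^ (-2 + ε + 1) / 6 - 1) (Ioc 0 1) := by
    refine Integrable.sub (Integrable.div_const ?_ _) (by simp)
    exact (intervalIntegrable_iff_integrableOn_Ioc_of_le zero_le_one).1
      (intervalIntegral.intervalIntegrable_rpow' hr)
  have hAv : ∫ t in Ioc (0 : ℝ) 1, (t ^ (-2 + ε + 1) / 6 - 1) = 1 / (6 * ε) - 1 := by
    rw [← intervalIntegral.integral_of_le zero_le_one, intervalIntegral.integral_sub
      ((intervalIntegral.intervalIntegrable_rpow' hr).div_const _) (by simp),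
      intervalIntegral.integral_div, integral_rpow (Or.inl hr)]
    have : -2 + ε + 1 + 1 = ε := by ring
    rw [this, Real.zero_rpow h0.ne']
    simp
    ring
  have hle : 1 / (6 * ε) - 1 ≤ ∫ t in Ioc (0 : ℝ) 1,
      Real.exp (-t) * (t ^ (-2 + ε + 1) - k * t) / (t + 1) := by
    rw [← hAv]
    refine setIntegral_mono_on hA (hi.mono_set Ioc_subset_Ioi_self) measurableSet_Ioc ?_
    rintro t ⟨ht0, ht1⟩
    have hp := Real.rpow_pos_of_pos ht0 (-2 + ε + 1)
    set p := t ^ (-2 + ε + 1)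
    have e1 : 1 / 3 ≤ Real.exp (-t) := by
      have : Real.exp (-1) ≤ Real.exp (-t) := Real.exp_le_exp.2 (by linarith)
      refine le_trans ?_ this
      rw [Real.exp_neg, one_div]
      exact inv_anti₀ (Real.exp_pos _) (by linarith [Real.exp_one_lt_d9])
    have e2 : Real.exp (-t) ≤ 1 := Real.exp_le_one_iff.2 (by linarith)
    have e3 : k * t ≤ 1 := by nlinarith
    rw [le_div_iff₀ (by linarith)]
    have e4 : p / 3 ≤ Real.exp (-t) * p := by nlinarith
    have e5 : Real.exp (-t) * (k * t) ≤ 1 := by nlinarith [Real.exp_pos (-t)]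
    nlinarith [mul_nonneg hp.le (by linarith : 0 ≤ 1 - t)]
  have hge : -1 ≤ ∫ t in Ioi (1 : ℝ),
      Real.exp (-t) * (t ^ (-2 + ε + 1) - k * t) / (t + 1) := by
    have hB : IntegrableOn (fun t : ℝ => -Real.exp (-t)) (Ioi 1) :=
      (integrableOn_exp_neg_Ioi 1).neg
    have hBv : -1 ≤ ∫ t in Ioi (1 : ℝ), -Real.exp (-t) := by
      rw [integral_neg, integral_exp_neg_Ioi]
      linarith [Real.exp_le_one_iff.2 (by norm_num : (-1 : ℝ) ≤ 0)]
    refine hBv.trans (setIntegral_mono_on hB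
      (hi.mono_set (Ioi_subset_Ioi zero_le_one)) measurableSet_Ioi ?_)
    intro t ht
    have ht1 : 1 < t := ht
    have hp := Real.rpow_pos_of_pos (by linarith : 0 < t) (-2 + ε + 1)
    have := Real.exp_pos (-t)
    rw [le_div_iff₀ (by linarith), neg_mul, ← mul_neg]
    refine mul_le_mul_of_nonneg_left ?_ this.le
    nlinarith
  have : 2 < 1 / (6 * ε) := by
    rw [lt_div_iff₀ (by linarith)]
    linarith
  linarith

lemma exp_neg_div_add_one_le {t : ℝ} (h0 : 0 ≤ t) (h1 : t ≤ 1) :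
    Real.exp (-t) / (t + 1) ≤ 1 - 7 / 5 * t + 13 / 20 * t ^ 2 := by
  have h := Real.quadratic_le_exp_of_nonneg h0
  have hq : 0 < 1 + t + t ^ 2 / 2 := by positivity
  have hP : 0 ≤ 3 / 5 - 13 / 20 * t - 3 / 10 * t ^ 2 + 11 / 40 * t ^ 3 + 13 / 40 * t ^ 4 := by
    nlinarith [sq_nonneg (t ^ 2 - 1 / 2), sq_nonneg (t - 7 / 10),
      mul_nonneg h0 (sq_nonneg (t - 7 / 10)), mul_nonneg h0 (sub_nonneg.2 h1), sq_nonneg (t ^ 2 - 7 / 10 * t)]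
  have hR : 1 ≤ (1 - 7 / 5 * t + 13 / 20 * t ^ 2) * (t + 1) * (1 + t + t ^ 2 / 2) := by
    nlinarith [mul_nonneg h0 hP]
  rw [div_le_iff₀ (by linarith), Real.exp_neg]
  calc (Real.exp t)⁻¹ ≤ (1 + t + t ^ 2 / 2)⁻¹ := inv_anti₀ hq h
    _ ≤ _ := by rwa [inv_le_iff_one_le_mul₀ hq]

lemma le_log_of_one_le {t : ℝ} (ht : 1 ≤ t) :
    11 / 20 * t - 1 / 20 * t ^ 2 - 11 / 20 * t⁻¹ + 1 / 20 ≤ Real.log t := by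
  let φ : ℝ → ℝ := fun t =>
    Real.log t - (11 / 20 * t - 1 / 20 * t ^ 2 - 11 / 20 * t⁻¹ + 1 / 20)
  have hd : ∀ s : ℝ, 0 < s → HasDerivAt φ
      (s⁻¹ - (11 / 20 - 1 / 20 * (2 * s) + 11 / 20 * (s ^ 2)⁻¹)) s := by
    intro s hs
    have := (Real.hasDerivAt_log hs.ne').sub (((((hasDerivAt_id s).const_mul (11 / 20)).sub
      ((hasDerivAt_pow 2 s).const_mul (1 / 20))).sub
      ((hasDerivAt_inv hs.ne').const_mul (11 / 20))).add_const (1 / 20))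
    exact this.congr_deriv (by simp)
  have hm : MonotoneOn φ (Ici 1) := by
    refine monotoneOn_of_deriv_nonneg (convex_Ici 1) ?_ ?_ ?_
    · exact fun s hs => (hd s (lt_of_lt_of_le one_pos hs)).continuousAt.continuousWithinAt
    · intro s hs
      rw [interior_Ici] at hs
      exact (hd s (one_pos.trans hs)).differentiableAt.differentiableWithinAt
    · intro s hs
      rw [interior_Ici] at hs
      have hs1 : 1 < s := hs
      rw [(hd s (one_pos.trans hs)).deriv]
      have : s⁻¹ - (11 / 20 - 1 / 20 * (2 * s) + 11 / 20 * (s ^ 2)⁻¹) =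
          (s - 1) * (2 * s ^ 2 - 9 * s + 11) / (20 * s ^ 2) := by
        field_simp
        ring
      rw [this]
      have : 0 ≤ 2 * s ^ 2 - 9 * s + 11 := by nlinarith [sq_nonneg (s - 9 / 4)]
      have : 0 ≤ s - 1 := by linarith
      positivity
  have h := hm (mem_Ici.2 le_rfl) (mem_Ici.2 ht) ht
  simp only [φ] at h
  norm_num at h
  linarith

lemma integral_log_mul_polynomial :
    ∫ t in (0 : ℝ)..1, t * Real.log t * (1 - 7 / 5 * t + 13 / 20 * t ^ 2) =
      -(1 / 4 - 7 / 45 + 13 / 320) := by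
  have hc := Real.continuous_mul_log
  have key := intervalIntegral.integral_eq_sub_of_hasDerivAt_of_le (a := (0 : ℝ)) (b := 1)
    (f := fun t => t * Real.log t * (t / 2 - 7 / 15 * t ^ 2 + 13 / 80 * t ^ 3)
      - (t ^ 2 / 4 - 7 / 45 * t ^ 3 + 13 / 320 * t ^ 4))
    (f' := fun t => t * Real.log t * (1 - 7 / 5 * t + 13 / 20 * t ^ 2))
    zero_le_one (by fun_prop) ?_ (Continuous.intervalIntegrable (by fun_prop) _ _)
  · rw [key]
    norm_num
  · intro t ht
    have ht0 : t ≠ 0 := ht.1.ne'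
    have h1 := (Real.hasDerivAt_mul_log ht0).mul ((((hasDerivAt_id t).div_const 2).sub
      ((hasDerivAt_pow 2 t).const_mul (7 / 15))).add ((hasDerivAt_pow 3 t).const_mul (13 / 80)))
    have h2 := (((hasDerivAt_pow 2 t).div_const 4).sub
      ((hasDerivAt_pow 3 t).const_mul (7 / 45))).add ((hasDerivAt_pow 4 t).const_mul (13 / 320))
    exact (h1.sub h2).congr_deriv (by simp; ring)

lemma integrableOn_and_integral_exp_neg_mul_quadratic :
    IntegrableOn (fun t : ℝ => Real.exp (-t) * ((t - 1) / 2 - (t - 1) ^ 2 / 20)) (Ioi 1) ∧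
    ∫ t in Ioi (1 : ℝ), Real.exp (-t) * ((t - 1) / 2 - (t - 1) ^ 2 / 20) =
      2 / 5 * Real.exp (-1) := by
  have hint : IntegrableOn
      (fun t : ℝ => Real.exp (-t) * ((t - 1) / 2 - (t - 1) ^ 2 / 20)) (Ioi 1) := by
    have h0 := integrableOn_exp_neg_mul_rpow (r := 0) (by norm_num)
    have h1 := integrableOn_exp_neg_mul_rpow (r := 1) (by norm_num)
    have h2 := integrableOn_exp_neg_mul_rpow (r := 2) (by norm_num)
    refine IntegrableOn.mono_set ?_ (Ioi_subset_Ioi zero_le_one)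
    refine (((h1.const_mul (3 / 5)).sub (h0.const_mul (11 / 20))).sub
      (h2.const_mul (1 / 20))).congr (ae_of_all _ fun t => ?_)
    simp
    ring
  refine ⟨hint, ?_⟩
  have hlim : Tendsto (fun t : ℝ => (t ^ 2 / 20 - t / 2 + 1 / 20) * Real.exp (-t)) atTop (𝓝 0) := by
    have l0 := Real.tendsto_pow_mul_exp_neg_atTop_nhds_zero 0
    have l1 := Real.tendsto_pow_mul_exp_neg_atTop_nhds_zero 1
    have l2 := Real.tendsto_pow_mul_exp_neg_atTop_nhds_zero 2
    have := ((l2.const_mul (1 / 20)).sub (l1.const_mul (1 / 2))).add (l0.const_mul (1 / 20))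
    convert this using 2
    · ring
    · simp
  rw [integral_Ioi_of_hasDerivAt_of_tendsto'
    (f := fun t : ℝ => (t ^ 2 / 20 - t / 2 + 1 / 20) * Real.exp (-t)) ?_ hint hlim]
  · norm_num
  · intro t _
    have h := (((((hasDerivAt_pow 2 t).div_const 20).sub ((hasDerivAt_id t).div_const 2)).add_const
      (1 / 20))).mul (hasDerivAt_id t).neg.exp
    exact h.congr_deriv (by simp; ring)

lemma mul_log_le_sub {t x k : ℝ} (ht : 0 < t) (hk : k ≤ 1) :
    x * (t * Real.log t) ≤ t ^ (x + 1) - k * t := by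
  have h1 : 1 + x * Real.log t ≤ t ^ x := by
    rw [Real.rpow_def_of_pos ht]
    linarith [Real.add_one_le_exp (Real.log t * x)]
  rw [Real.rpow_add_one ht.ne']
  nlinarith

lemma reAltKurepa_pos_of_pos {x : ℝ} (hx : 0 < x) : 0 < reAltKurepa x := by
  set k := Real.cos (Real.pi * x) with hkdef
  have hk : |k| ≤ 1 := Real.abs_cos_le_one _
  have hk1 : k ≤ 1 := (abs_le.1 hk).2
  have hi := integrableOn_reAltKurepa_integrand (r := x + 1) (by linarith) hk
  rw [reAltKurepa_eq_add (by linarith), ← hkdef]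
  have hlow : ∀ t : ℝ, 0 < t → Real.exp (-t) * (x * (t * Real.log t)) / (t + 1) ≤
      Real.exp (-t) * (t ^ (x + 1) - k * t) / (t + 1) := by
    intro t ht
    have := mul_log_le_sub (x := x) ht hk1
    gcongr
  have hA : x * -(1 / 4 - 7 / 45 + 13 / 320) ≤ ∫ t in Ioc (0 : ℝ) 1,
      Real.exp (-t) * (t ^ (x + 1) - k * t) / (t + 1) := by
    have hc := Real.continuous_mul_log
    rw [← integral_log_mul_polynomial, ← intervalIntegral.integral_const_mul,
      intervalIntegral.integral_of_le zero_le_one]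
    refine setIntegral_mono_on
      ((intervalIntegrable_iff_integrableOn_Ioc_of_le zero_le_one).1
        (Continuous.intervalIntegrable (by fun_prop) _ _))
      (hi.mono_set Ioc_subset_Ioi_self) measurableSet_Ioc ?_
    rintro t ⟨ht0, ht1⟩
    refine le_trans ?_ (hlow t ht0)
    have h1 := exp_neg_div_add_one_le ht0.le ht1
    have h2 : 0 ≤ -(x * (t * Real.log t)) := by
      have := Real.log_nonpos ht0.le ht1
      have : 0 ≤ x * (t * -Real.log t) := by
        have : 0 ≤ -Real.log t := by linarith
        positivity
      linarith
    have h3 := mul_le_mul_of_nonneg_left h1 h2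
    rw [mul_comm (Real.exp (-t)), mul_div_assoc]
    linarith
  have hB : x * (2 / 5 * Real.exp (-1)) ≤ ∫ t in Ioi (1 : ℝ),
      Real.exp (-t) * (t ^ (x + 1) - k * t) / (t + 1) := by
    obtain ⟨hq, hv⟩ := integrableOn_and_integral_exp_neg_mul_quadratic
    rw [← hv, ← integral_const_mul]
    refine setIntegral_mono_on (hq.const_mul x)
      (hi.mono_set (Ioi_subset_Ioi zero_le_one)) measurableSet_Ioi ?_
    intro t ht
    have ht1 : 1 < t := ht
    have ht0 : 0 < t := by linarith
    refine le_trans ?_ (hlow t ht0)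
    have h1 := mul_le_mul_of_nonneg_left (le_log_of_one_le ht1.le) ht0.le
    have h2 : t * (11 / 20 * t - 1 / 20 * t ^ 2 - 11 / 20 * t⁻¹ + 1 / 20) =
        ((t - 1) / 2 - (t - 1) ^ 2 / 20) * (t + 1) := by
      field_simp
      ring
    rw [h2, ← le_div_iff₀ (by linarith)] at h1
    have h3 := mul_le_mul_of_nonneg_left h1 (mul_pos hx (Real.exp_pos (-t))).le
    calc _ = x * Real.exp (-t) * ((t - 1) / 2 - (t - 1) ^ 2 / 20) := by ring
      _ ≤ _ := h3
      _ = _ := by ring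
  have he : 9 / 25 ≤ Real.exp (-1) := by
    rw [Real.exp_neg, le_inv_comm₀ (by norm_num) (Real.exp_pos _)]
    linarith [Real.exp_one_lt_d9]
  nlinarith

lemma reAltKurepa_zero : reAltKurepa 0 = 0 := by
  simp [reAltKurepa]

/-- Let `x₁ ∈ (−2, 0)` be the unique zero of `F` in `(−2, 0)`.  Then for every
`x ∈ (−1, 1+x₁] ∪ [1, ∞)` one has `Γ(x+1) ≥ F(x)`, with equality iff `x = 1+x₁` or `x = 1`. -/
theorem gamma_ge_reAltKurepa (x₁ : ℝ) (hx₁ : x₁ ∈ Set.Ioo (-2 : ℝ) 0)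
    (hzero : reAltKurepa x₁ = 0)
    (huniq : ∀ y ∈ Set.Ioo (-2 : ℝ) 0, reAltKurepa y = 0 → y = x₁)
    (x : ℝ) (hx : x ∈ Set.Ioc (-1 : ℝ) (1 + x₁) ∪ Set.Ici (1 : ℝ)) :
    Real.Gamma (x + 1) ≥ reAltKurepa x ∧
      (Real.Gamma (x + 1) = reAltKurepa x ↔ x = 1 + x₁ ∨ x = 1) := by
  have hx' : -1 < x := by
    rcases hx with h | h
    · exact h.1
    · linarith [mem_Ici.1 h]
  suffices h : 0 ≤ reAltKurepa (x - 1) ∧ (reAltKurepa (x - 1) = 0 ↔ x = 1 + x₁ ∨ x = 1) by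
    rw [← reAltKurepa_add_reAltKurepa_sub_one hx']
    exact ⟨by linarith [h.1], by rw [add_eq_left]; exact h.2⟩
  have of_pos : 0 < reAltKurepa (x - 1) →
      0 ≤ reAltKurepa (x - 1) ∧ (reAltKurepa (x - 1) = 0 ↔ x = 1 + x₁ ∨ x = 1) := by
    refine fun h => ⟨h.le, fun h0 => absurd h0 h.ne', ?_⟩
    rintro (rfl | rfl)
    · rwa [add_sub_cancel_left]
    · rw [sub_self]; exact reAltKurepa_zero
  rcases hx with h | h
  · rcases h.2.eq_or_lt with rfl | hlt
    · simp [hzero]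
    · refine of_pos ?_
      by_contra! hneg
      obtain ⟨ε, hε0, hε⟩ := exists_between (lt_min (by linarith : 0 < x + 1)
        (by norm_num : (0 : ℝ) < 1 / 12))
      obtain ⟨hε1, hε2⟩ := lt_min_iff.1 hε
      have hpos := reAltKurepa_pos_of_near_neg_two hε0 hε2
      have hcont := (continuousOn_reAltKurepa (a := -2 + ε) (by linarith)).mono
        (Icc_subset_Icc_right (by linarith [hx₁.2] : x - 1 ≤ 0))
      obtain ⟨z, hz, hz0⟩ := intermediate_value_Icc' (by linarith) hcont ⟨hneg, hpos.le⟩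
      have := huniq z ⟨by linarith [hz.1], by linarith [hz.2, hx₁.2]⟩ hz0
      linarith [hz.2]
  · rcases (mem_Ici.1 h).eq_or_lt with rfl | hlt
    · simp [reAltKurepa_zero]
    · exact of_pos (reAltKurepa_pos_of_pos (by linarith))
end
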